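/- arXiv:0805.1342 — 2 statements merged into one kernel-verified Lean document; each statement's English description precedes it below -/
import Mathlib

section
/- Let 𝔤 be a finite-dimensional Lie algebra over k. Then d(𝔤) = 0 if and only if the Zariski-closed set 𝔤* \ 𝔤*_reg has codimension ≥ 2 in the affine space 𝔤*. -/
open Module MvPolynomial

namespace Paper

variable (k : Type) [Field k]

/-- The stabilizer `𝔤_x` of `x ∈ 𝔤*`. -/
def stab (L : Type) [LieRing L] [LieAlgebra k L] (x : Module.Dual k L) : Submodule k L where
  carrier := {v | ∀ w, x ⁅v, w⁆ = 0}
  add_mem' := by intro a b ha hb w; simp [add_lie, ha w, hb w]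
  zero_mem' := by intro w; simp
  smul_mem' := by intro c a ha w; simp [smul_lie, ha w]

/-- The index `i(𝔤)` of a Lie algebra: the minimal dimension of a stabilizer. -/
noncomputable def lieIndex (L : Type) [LieRing L] [LieAlgebra k L] : ℕ :=
  ⨅ x : Module.Dual k L, finrank k (stab k L x)

/-- The set of non-regular elements `𝔤* \ 𝔤*_reg`. -/
def nonReg (L : Type) [LieRing L] [LieAlgebra k L] : Set (Module.Dual k L) :=
  {x | finrank k (stab k L x) ≠ lieIndex k L}

variable {k}
variable {L : Type} [LieRing L] [LieAlgebra k L]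

/-- The element of the polynomial model of the symmetric algebra `S(V)`
(w.r.t. the basis `bV`) corresponding to a vector `v ∈ V`. -/
noncomputable def rep {ι V : Type} [Fintype ι] [AddCommGroup V] [Module k V]
    (bV : Basis ι k V) (v : V) : MvPolynomial ι k :=
  ∑ i, MvPolynomial.C (bV.repr v i) * MvPolynomial.X i

/-- The action of `v ∈ 𝔤` on the symmetric algebra `S(V)` of a `𝔤`-module `V`,
as a derivation (extending `w ↦ v · w = ⁅v, w⁆`). -/
noncomputable def actDer {ι V : Type} [Fintype ι] [AddCommGroup V] [Module k V]
    [LieRingModule L V] (bV : Basis ι k V) (v : L) :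
    Derivation k (MvPolynomial ι k) (MvPolynomial ι k) :=
  MvPolynomial.mkDerivation k fun i => rep bV ⁅v, bV i⁆

/-- Semi-invariants in `S(V)` for the action of a (sub)space `A` mapping to `𝔤` via `em`:
nonzero `f` with `a · f = χ(a) • f` for some weight `χ ∈ A*`. -/
noncomputable def semiInvSet {ι V A : Type} [Fintype ι] [AddCommGroup V] [Module k V]
    [LieRingModule L V] [AddCommGroup A] [Module k A]
    (bV : Basis ι k V) (em : A → L) : Set (MvPolynomial ι k) :=
  {f | f ≠ 0 ∧ ∃ χ : Module.Dual k A, ∀ a : A, actDer bV (em a) f = χ a • f}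

/-- The semi-center: the subalgebra generated by all semi-invariants. -/
noncomputable def semiCenter {ι V A : Type} [Fintype ι] [AddCommGroup V] [Module k V]
    [LieRingModule L V] [AddCommGroup A] [Module k A]
    (bV : Basis ι k V) (em : A → L) : Subalgebra k (MvPolynomial ι k) :=
  Algebra.adjoin k (semiInvSet bV em)

/-- The subalgebra of invariants in `S(V)`. -/
noncomputable def invariants {ι V A : Type} [Fintype ι] [AddCommGroup V] [Module k V]
    [LieRingModule L V] (bV : Basis ι k V) (em : A → L) : Subalgebra k (MvPolynomial ι k) where
  carrier := {f | ∀ a : A, actDer bV (em a) f = 0}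
  mul_mem' := by intro f g hf hg a; simp [Derivation.leibniz, hf a, hg a]
  one_mem' := by intro a; simp
  add_mem' := by intro f g hf hg a; simp [hf a, hg a]
  zero_mem' := by intro a; simp
  algebraMap_mem' := by intro c a; simp

/-- The structure matrix `B = ([v_i, v_j])_{ij}` of `𝔤` w.r.t. a basis. -/
noncomputable def structMat {ι : Type} [Fintype ι] (b : Basis ι k L) :
    Matrix ι ι (MvPolynomial ι k) :=
  Matrix.of fun i j => rep b ⁅b i, b j⁆

/-- The set of `s × s` minors of the structure matrix. -/
noncomputable def minorsSet {ι : Type} [Fintype ι] [DecidableEq ι] (b : Basis ι k L) (s : ℕ) :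
    Set (MvPolynomial ι k) :=
  {p | ∃ f g : Fin s ↪ ι, p = ((structMat b).submatrix f g).det}

/-- `g` is a greatest common divisor of the set `A`. -/
def IsGcdOf {α : Type} [CommMonoidWithZero α] (g : α) (A : Set α) : Prop :=
  (∀ a ∈ A, g ∣ a) ∧ ∀ c, (∀ a ∈ A, c ∣ a) → c ∣ g

/-- The Pfaffian of an `n × n` matrix (`n = 2m` even), via the standard formula
`pf(A) = (2^m m!)⁻¹ Σ_σ sgn(σ) Π_i A_{σ(2i) σ(2i+1)}` (valid in characteristic zero). -/
noncomputable def pfaffian {n : ℕ} {R : Type} [CommRing R] [Algebra ℚ R]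
    (A : Matrix (Fin n) (Fin n) R) : R :=
  ((2 ^ (n / 2) * (n / 2).factorial : ℚ)⁻¹) •
    ∑ σ : Equiv.Perm (Fin n), (Equiv.Perm.sign σ : ℤ) •
      ∏ i : Fin (n / 2),
        A (σ ⟨2 * i.1, by have := i.2; omega⟩) (σ ⟨2 * i.1 + 1, by have := i.2; omega⟩)

/-- The set of Pfaffians of the principal `s × s` minors of the structure matrix. -/
noncomputable def principalPfaffians {ι : Type} [Fintype ι] [DecidableEq ι] [CharZero k]
    (b : Basis ι k L) (s : ℕ) : Set (MvPolynomial ι k) :=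
  {p | ∃ f : Fin s ↪ ι, p = pfaffian ((structMat b).submatrix f f)}

/-- Evaluation of a polynomial in `S𝔤` at a point `x ∈ 𝔤*`. -/
noncomputable def evalAt {ι : Type} [Fintype ι] (b : Basis ι k L) (x : Module.Dual k L) :
    MvPolynomial ι k →ₐ[k] k :=
  MvPolynomial.aeval fun i => x (b i)

/-- The vanishing ideal of a subset `Z ⊆ 𝔤*`. -/
noncomputable def vanIdeal {ι : Type} [Fintype ι] (b : Basis ι k L)
    (Z : Set (Module.Dual k L)) : Ideal (MvPolynomial ι k) where
  carrier := {f | ∀ x ∈ Z, evalAt b x f = 0}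
  add_mem' := by intro f g hf hg x hx; simp [map_add, hf x hx, hg x hx]
  zero_mem' := by intro x hx; simp
  smul_mem' := by intro c f hf x hx; simp [smul_eq_mul, map_mul, hf x hx]

/-- The dimension (Krull dimension of the coordinate ring) of the Zariski closure of
a subset `Z ⊆ 𝔤*`. -/
noncomputable def closedDim {ι : Type} [Fintype ι] (b : Basis ι k L)
    (Z : Set (Module.Dual k L)) : WithBot (WithTop ℕ) :=
  ringKrullDim (MvPolynomial ι k ⧸ vanIdeal b Z)

/-- The rank `r_𝔞(V)` of the structure matrix of the `𝔤`-module `V` with respect to a family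
`vs` spanning the acting subalgebra `𝔞`, computed over the fraction field of `S(V)`. -/
noncomputable def rkFam {ι V κ : Type} [Fintype ι] [DecidableEq ι] [Fintype κ]
    [AddCommGroup V] [Module k V] [LieRingModule L V]
    (bV : Basis ι k V) (vs : κ → L) : ℕ :=
  Matrix.rank ((Matrix.of fun (j : ι) (i : κ) => rep bV ⁅vs i, bV j⁆).map
    (algebraMap (MvPolynomial ι k) (FractionRing (MvPolynomial ι k))))

/-- The map `ρ : A ⊗_k 𝔤 → Der_k(A)` induced by an action of `𝔤` (given on a basis `bG`)
by derivations on a commutative `k`-algebra `A`; `ρ(a ⊗ v) = a • D(v)`. -/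
noncomputable def rhoMap {A G κ : Type} [CommRing A] [Algebra k A]
    [AddCommGroup G] [Module k G]
    (bG : Basis κ k G) (D : G → Derivation k A A) :
    TensorProduct k A G →ₗ[A] (A →ₗ[k] A) :=
  (Basis.baseChange A bG).constr k fun i => (D (bG i)).toLinearMap

/-- The invariant subfield `F^𝔤` for an action of `𝔤` by derivations on a field `F ⊇ k`. -/
noncomputable def invField {F G : Type} [Field F] [Algebra k F]
    (D : G → Derivation k F F) : IntermediateField k F where
  carrier := {x | ∀ v : G, D v x = 0}
  mul_mem' := by intro a b ha hb v; simp [Derivation.leibniz, ha v, hb v]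
  one_mem' := by intro v; simp
  add_mem' := by intro a b ha hb v; simp [ha v, hb v]
  zero_mem' := by intro v; simp
  algebraMap_mem' := by intro c v; simp
  inv_mem' := by
    intro x hx v
    rcases eq_or_ne x 0 with h | h
    · simp [h]
    · have h1 : D v (x * x⁻¹) = 0 := by
        rw [mul_inv_cancel₀ h]; simp
      rw [Derivation.leibniz] at h1
      have h2 : x • D v x⁻¹ = 0 := by
        rw [hx v] at h1; simpa using h1
      rcases smul_eq_zero.1 h2 with h3 | h3
      · exact absurd h3 h
      · exact h3

/-- The action of `𝔤` on a field `F` by derivations is *geometric* if the natural map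
`F ⊗_{F^𝔤} 𝔤 → Der_{F^𝔤}(F)` is surjective, i.e. every `k`-derivation of `F` vanishing
on the invariant subfield `F^𝔤` lies in the `F`-span of the derivations coming from `𝔤`. -/
def IsGeometric {F G : Type} [Field F] [Algebra k F]
    (D : G → Derivation k F F) : Prop :=
  ∀ E : Derivation k F F, (∀ x : F, (∀ v : G, D v x = 0) → E x = 0) →
    E.toLinearMap ∈ Submodule.span F (Set.range fun v : G => (D v).toLinearMap)


/-- The subalgebra of invariants for an action of `G` by derivations on a
commutative `k`-algebra `A`. -/
noncomputable def invariantsOf {A G : Type} [CommRing A] [Algebra k A]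
    (D : G → Derivation k A A) : Subalgebra k A where
  carrier := {f | ∀ v : G, D v f = 0}
  mul_mem' := by intro f g hf hg v; simp [Derivation.leibniz, hf v, hg v]
  one_mem' := by intro v; simp
  add_mem' := by intro f g hf hg v; simp [hf v, hg v]
  zero_mem' := by intro v; simp
  algebraMap_mem' := by intro c v; simp

/-- The map `ρ* : S(V) ⊗ V → S(V) ⊗ 𝔤*` dual to the action map, determined by
`ρ*(1 ⊗ w)(v) = v · w`. -/
noncomputable def rhoStar {ι ιV V : Type} [Fintype ι] [Fintype ιV]
    [AddCommGroup V] [Module k V] [LieRingModule L V]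
    (b : Basis ι k L) (bV : Basis ιV k V) :
    TensorProduct k (MvPolynomial ιV k) V →ₗ[MvPolynomial ιV k]
      TensorProduct k (MvPolynomial ιV k) (Module.Dual k L) :=
  (Basis.baseChange (MvPolynomial ιV k) bV).constr k fun j =>
    ∑ i, (rep bV ⁅b i, bV j⁆) ⊗ₜ[k] (b.coord i)

/-- A bundled finite-dimensional Lie algebra over `k` together with a finite basis
(providing a polynomial model of its symmetric algebra). -/
structure FDLieModel (k : Type) [Field k] where
  carrier : Type
  [lieRing : LieRing carrier]
  [lieAlg : LieAlgebra k carrier]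
  ind : Type
  [fin : Fintype ind]
  [deceq : DecidableEq ind]
  basis : Basis ind k carrier

attribute [instance] FDLieModel.lieRing FDLieModel.lieAlg FDLieModel.fin FDLieModel.deceq


section MatrixRank

variable {K m n : Type} [Field K] [Fintype m] [Fintype n]

/-- A matrix of rank at least `s` has `s` linearly independent rows. -/
lemma exists_embedding_linearIndependent_rows (A : Matrix m n K) {s : ℕ} (hs : s ≤ A.rank) :
    ∃ f : Fin s ↪ m, LinearIndependent K (A.submatrix f id).row := by
  obtain ⟨κ, a, ha, hspan, hli⟩ := exists_linearIndependent' K A.row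
  have : Fintype κ := Fintype.ofInjective a ha
  have hcard : s ≤ Fintype.card κ := by
    rwa [linearIndependent_iff_card_eq_finrank_span.mp hli, Set.finrank, hspan,
      ← A.rank_eq_finrank_span_row]
  let e : Fin s ↪ κ := (Fin.castLEEmb hcard).trans (Fintype.equivFin κ).symm.toEmbedding
  exact ⟨e.trans ⟨a, ha⟩, hli.comp e e.injective⟩

/-- The rank of a matrix is at least `s` iff some `s × s` minor is nonzero. -/
lemma le_rank_iff_exists_minor_ne_zero (A : Matrix m n K) (s : ℕ) :
    s ≤ A.rank ↔ ∃ (f : Fin s ↪ m) (g : Fin s ↪ n), (A.submatrix f g).det ≠ 0 := by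
  constructor
  · intro hs
    obtain ⟨f, hf⟩ := exists_embedding_linearIndependent_rows A hs
    have hs' : s ≤ (A.submatrix f id).transpose.rank := by
      rw [Matrix.rank_transpose, hf.rank_matrix, Fintype.card_fin]
    obtain ⟨g, hg⟩ := exists_embedding_linearIndependent_rows _ hs'
    refine ⟨f, g, ?_⟩
    rw [← Matrix.det_transpose]
    exact ((Matrix.isUnit_iff_isUnit_det _).mp
      (Matrix.linearIndependent_rows_iff_isUnit.mp hg)).ne_zero
  · rintro ⟨f, g, h⟩
    calc s = (A.submatrix f g).rank := by
          rw [Matrix.rank_of_det_ne_zero h, Fintype.card_fin]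
      _ ≤ A.rank := Matrix.rank_submatrix_le A f g

end MatrixRank

section PolynomialDimension

variable {σ : Type}

/-- The automorphism of the polynomial ring translating the variables by `c`. -/
noncomputable def translateEquiv (c : σ → k) : MvPolynomial σ k ≃ₐ[k] MvPolynomial σ k :=
  AlgEquiv.ofAlgHom (aeval fun i => X i + C (c i)) (aeval fun i => X i - C (c i))
    (by ext i; simp) (by ext i; simp)

lemma aeval_translateEquiv (x c : σ → k) (p : MvPolynomial σ k) :
    aeval x (translateEquiv c p) = aeval (x + c) p := by
  have : (aeval x).comp (translateEquiv c).toAlgHom = aeval (R := k) (x + c) := by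
    ext i; simp [translateEquiv]
  exact DFunLike.congr_fun this p

lemma height_vanishingIdeal_singleton (x y : σ → k) :
    (vanishingIdeal k {x}).height = (vanishingIdeal k {y}).height := by
  rw [← (translateEquiv (y - x)).toRingEquiv.height_comap]
  congr 1
  ext p
  simp [aeval_translateEquiv]

/-- A hypersurface in affine space over an algebraically closed field has codimension at most
one. -/
lemma ringKrullDim_le_quotient_span_singleton_add_one [IsAlgClosed k] [Finite σ]
    {p : MvPolynomial σ k} (hp : ¬ IsUnit p) :
    ringKrullDim (MvPolynomial σ k) ≤
      ringKrullDim (MvPolynomial σ k ⧸ Ideal.span {p}) + 1 := by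
  obtain ⟨M, hM, hpM⟩ := exists_max_ideal_of_mem_nonunits hp
  obtain ⟨x, rfl⟩ := eq_vanishingIdeal_singleton_of_isMaximal k hM
  refine (ringKrullDim_le_iff_isMaximal_height_le _).mpr fun N hN => ?_
  obtain ⟨y, rfl⟩ := eq_vanishingIdeal_singleton_of_isMaximal k hN
  rw [height_vanishingIdeal_singleton y x]
  exact Ideal.height_le_ringKrullDim_quotient_add_one hpM

end PolynomialDimension

/-- In a unique factorization domain, an ideal containing a nonzero element and contained in no
principal prime ideal has codimension at least two. -/
lemma ringKrullDim_quotient_add_two_le {R : Type} [CommRing R] [IsDomain R]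
    [UniqueFactorizationMonoid R] {I : Ideal R} (hI : I ≠ ⊥)
    (hp : ∀ p, Prime p → ¬ I ≤ Ideal.span {p}) :
    ringKrullDim (R ⧸ I) + 2 ≤ ringKrullDim R := by
  by_cases htop : I = ⊤
  · rw [htop, ringKrullDim_eq_bot_of_subsingleton]
    simp
  have : Nonempty (PrimeSpectrum.zeroLocus (R := R) I) := by
    rwa [Set.nonempty_coe_sort, Set.nonempty_iff_ne_empty, ne_eq,
      PrimeSpectrum.zeroLocus_empty_iff_eq_top]
  rw [ringKrullDim_quotient, Order.krullDim_eq_iSup_length, ringKrullDim,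
    Order.krullDim_eq_iSup_length, ← WithBot.coe_ofNat, ← WithBot.coe_add,
    ENat.iSup_add, WithBot.coe_le_coe, iSup_le_iff]
  intro l
  have hIl : I ≤ l.head.1.asIdeal := l.head.2
  obtain ⟨q, hql, hq⟩ := l.head.1.isPrime.exists_mem_prime_of_ne_bot
    fun h => hI (le_bot_iff.mp (hIl.trans h.le))
  let Q : PrimeSpectrum R :=
    ⟨Ideal.span {q}, (Ideal.span_singleton_prime hq.ne_zero).mpr hq⟩
  have hQ : Q < l.head.1 := by
    refine lt_of_le_of_ne ((Ideal.span_singleton_le_iff_mem _).mpr hql) fun h => hp q hq ?_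
    exact hIl.trans (congrArg PrimeSpectrum.asIdeal h).ge
  have hbot : (⊥ : PrimeSpectrum R) < Q := by
    refine lt_of_le_of_ne bot_le fun h => hq.ne_zero ?_
    have h' : Ideal.span {q} = ⊥ := (congrArg PrimeSpectrum.asIdeal h).symm
    exact Ideal.span_singleton_eq_bot.mp h'
  refine le_trans ?_ (le_iSup _
    (((l.map Subtype.val (fun _ _ ↦ id)).cons Q hQ).cons ⊥ hbot))
  norm_cast
  change l.length + 2 ≤ 0 + (0 + l.length + 1) + 1
  omega

lemma not_natCast_le_add_one_of_add_two_le {n : ℕ} {d : WithBot ℕ∞} (h : d + 2 ≤ n) :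
    ¬ (n : WithBot ℕ∞) ≤ d + 1 := by
  intro h'
  induction d with
  | bot => exact absurd h' (by simp)
  | coe d =>
    have h₂ : d + 2 ≤ (n : ℕ∞) := WithBot.coe_le_coe.mp h
    have h₁ : (n : ℕ∞) ≤ d + 1 := WithBot.coe_le_coe.mp h'
    induction d using ENat.recTopCoe with
    | top => simp at h₂
    | coe d => norm_cast at h₁ h₂; omega

section Regular

variable {ι : Type} [Fintype ι] (b : Basis ι k L)

lemma evalAt_rep (x : Module.Dual k L) (v : L) : evalAt b x (rep b v) = x v := by
  conv_rhs => rw [← b.sum_repr v]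
  simp [evalAt, rep, -Basis.sum_repr]

lemma map_structMat (x : Module.Dual k L) :
    (structMat b).map (evalAt b x) = Matrix.of fun i j => x ⁅b i, b j⁆ := by
  ext i j
  simp [structMat, evalAt_rep]

/-- The stabilizer of `x` is the kernel of the structure matrix evaluated at `x`. -/
lemma finrank_stab_add_rank (x : Module.Dual k L) :
    finrank k (stab k L x) + ((structMat b).map (evalAt b x)).rank = finrank k L := by
  have := Module.Finite.of_basis b
  let N : Matrix ι ι k := Matrix.of fun i j => x ⁅b i, b j⁆
  let φ : L →ₗ[k] ι → k := N.transpose.mulVecLin ∘ₗ b.equivFun.toLinearMap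
  have hφ (v : L) (j : ι) : φ v j = x ⁅v, b j⁆ := by
    conv_rhs => rw [← b.sum_repr v]
    simp [φ, N, Matrix.vecMul, dotProduct, sum_lie, -Basis.sum_repr]
  have hker : LinearMap.ker φ = stab k L x := by
    ext v
    refine ⟨fun h w => ?_, fun h => funext fun j => (hφ v j).trans (h (b j))⟩
    rw [← b.sum_repr w]
    simp [lie_sum, ← hφ, LinearMap.mem_ker.mp h, -Basis.sum_repr]
  have hrange : finrank k (LinearMap.range φ) = N.rank := by
    rw [LinearMap.range_comp_of_range_eq_top _ (LinearEquiv.range _), ← Matrix.rank_transpose N]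
    rfl
  rw [map_structMat, ← hker, ← hrange, add_comm, LinearMap.finrank_range_add_finrank_ker]

/-- The non-regular elements are the common zeros of the minors of maximal size. -/
lemma mem_nonReg_iff [DecidableEq ι] (x : Module.Dual k L) :
    x ∈ nonReg k L ↔
      ∀ p ∈ minorsSet b (finrank k L - lieIndex k L), evalAt b x p = 0 := by
  have hle : lieIndex k L ≤ finrank k (stab k L x) := ciInf_le (OrderBot.bddBelow _) x
  have hsum := finrank_stab_add_rank b x
  have hlt : x ∈ nonReg k L ↔
      ¬ finrank k L - lieIndex k L ≤ ((structMat b).map (evalAt b x)).rank := by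
    rw [nonReg, Set.mem_ofPred_eq]
    omega
  rw [hlt, le_rank_iff_exists_minor_ne_zero]
  push Not
  have hdet (s : ℕ) (f g : Fin s ↪ ι) :
      (((structMat b).map (evalAt b x)).submatrix f g).det =
        evalAt b x ((structMat b).submatrix f g).det := by
    rw [AlgHom.map_det]; rfl
  simp only [hdet, minorsSet, Set.mem_ofPred_eq]
  exact ⟨by rintro h _ ⟨f, g, rfl⟩; exact h f g, fun h f g => h _ ⟨f, g, rfl⟩⟩

variable (k L) in
lemma exists_notMem_nonReg : ∃ x, x ∉ nonReg k L := by
  obtain ⟨x, hx⟩ := ciInf_mem fun x : Module.Dual k L => finrank k (stab k L x)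
  exact ⟨x, fun h => h hx⟩

lemma exists_mem_minorsSet_ne_zero [DecidableEq ι] :
    ∃ p ∈ minorsSet b (finrank k L - lieIndex k L), p ≠ 0 := by
  obtain ⟨x, hx⟩ := exists_notMem_nonReg k L
  rw [mem_nonReg_iff b] at hx
  push Not at hx
  obtain ⟨p, hp, hpx⟩ := hx
  exact ⟨p, hp, fun h => hpx (by rw [h, map_zero])⟩

/-- If `p` is prime and `Z` contains the hypersurface `p = 0`, then every polynomial vanishing
on `Z` is a multiple of `p`. -/
lemma vanIdeal_le_span_singleton [IsAlgClosed k] {p : MvPolynomial ι k} (hp : Prime p)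
    {Z : Set (Module.Dual k L)} (hZ : ∀ x, evalAt b x p = 0 → x ∈ Z) :
    vanIdeal b Z ≤ Ideal.span {p} := by
  have : (Ideal.span {p}).IsPrime := (Ideal.span_singleton_prime hp.ne_zero).mpr hp
  intro f hf
  rw [← IsPrime.vanishingIdeal_zeroLocus (K := k) (Ideal.span {p}), mem_vanishingIdeal_iff]
  intro y hy
  have hy' : evalAt b (b.constr k y) = aeval y := by simp [evalAt, b.constr_basis]
  rw [← hy']
  refine hf _ (hZ _ ?_)
  rw [hy']
  exact hy p (Ideal.mem_span_singleton_self p)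

end Regular

/-- `d(𝔤) = 0` (the fundamental semi-invariant, i.e. the gcd of the
`s × s` minors of the structure matrix with `s = dim 𝔤 − i(𝔤)`, has degree `0`)
iff `𝔤* \ 𝔤*_reg` has codimension `≥ 2` in `𝔤*`. -/
theorem statement4 {k : Type} [Field k] [IsAlgClosed k] [CharZero k]
    {L : Type} [LieRing L] [LieAlgebra k L]
    {ι : Type} [Fintype ι] [DecidableEq ι] (b : Basis ι k L)
    (g : MvPolynomial ι k)
    (hg : IsGcdOf g (minorsSet b (finrank k L - lieIndex k L))) :
    g.totalDegree = 0 ↔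
      closedDim b (nonReg k L) + 2 ≤ ringKrullDim (MvPolynomial ι k) := by
  set A := minorsSet b (finrank k L - lieIndex k L)
  obtain ⟨m, hmA, hm⟩ := exists_mem_minorsSet_ne_zero b
  have hg0 : g ≠ 0 := fun h => hm (zero_dvd_iff.mp (h ▸ hg.1 m hmA))
  have hAI : A ⊆ vanIdeal b (nonReg k L) := fun p hp x hx => (mem_nonReg_iff b x).mp hx p hp
  constructor
  · intro hdeg
    have hgu : IsUnit g := by
      rw [totalDegree_eq_zero_iff_eq_C] at hdeg
      rw [hdeg] at hg0 ⊢
      exact (isUnit_iff_ne_zero.mpr fun h => hg0 (by rw [h, C_0])).map C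
    refine ringKrullDim_quotient_add_two_le (fun h => hm ?_) fun p hp hle => hp.not_isUnit ?_
    · simpa [h] using hAI hmA
    · exact isUnit_of_dvd_unit
        (hg.2 p fun a ha => Ideal.mem_span_singleton.mp (hle (hAI ha))) hgu
  · intro hdim
    by_contra hdeg
    have hgu : ¬ IsUnit g := fun h => hdeg (isUnit_iff_totalDegree_of_isReduced.mp h).2
    obtain ⟨p, hp, hpg⟩ := WfDvdMonoid.exists_irreducible_factor hgu hg0
    have hle : vanIdeal b (nonReg k L) ≤ Ideal.span {p} := by
      refine vanIdeal_le_span_singleton b hp.prime fun x hx => (mem_nonReg_iff b x).mpr ?_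
      intro q hq
      obtain ⟨r, rfl⟩ := hpg.trans (hg.1 q hq)
      rw [map_mul, hx, zero_mul]
    have hquot : ringKrullDim (MvPolynomial ι k ⧸ Ideal.span {p}) ≤
        ringKrullDim (MvPolynomial ι k ⧸ vanIdeal b (nonReg k L)) :=
      ringKrullDim_le_of_surjective (Ideal.Quotient.factor hle)
        (Ideal.Quotient.factor_surjective hle)
    have hhyp := (ringKrullDim_le_quotient_span_singleton_add_one hp.not_isUnit).trans
      (add_le_add_left hquot 1)
    rw [ringKrullDim_of_isNoetherianRing, ringKrullDim_eq_zero_of_field, zero_add] at hdim hhyp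
    exact not_natCast_le_add_one_of_add_two_le hdim hhyp

end Paper
end

section
/- Let 𝔤 be a finite-dimensional Lie algebra over k and let 𝔥 be an ideal of 𝔤 of codimension one. Then at least one of the two inclusions (S𝔥)^𝔤_si ⊆ (S𝔥)^𝔥_si and (S𝔥)^𝔤_si ⊆ (S𝔤)^𝔤_si is an equality. Equivalently: either (S𝔥)^𝔥_si ⊆ (S𝔤)^𝔤_si or (S𝔤)^𝔤_si ⊆ (S𝔥)^𝔥_si. -/
open Module MvPolynomial

namespace Paper

variable (k : Type) [Field k]

variable {k}
variable {L : Type} [LieRing L] [LieAlgebra k L]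

section FormDer

variable {ι : Type}

/-- The derivation of `S𝔤` extending a linear form on `𝔤`. -/
noncomputable def formDer (b : Basis ι k L) (φ : Module.Dual k L) :
    Derivation k (MvPolynomial ι k) (MvPolynomial ι k) :=
  mkDerivation k fun i => C (φ (b i))

lemma formDer_X (b : Basis ι k L) (φ : Module.Dual k L) (i : ι) :
    formDer b φ (X i) = C (φ (b i)) :=
  mkDerivation_X _ _ _

lemma formDer_iterate_X_mul (b : Basis ι k L) (φ : Module.Dual k L) (i : ι) (n : ℕ) :
    ∀ p, (formDer b φ)^[n] p = 0 → (formDer b φ)^[n + 1] (p * X i) = 0 := by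
  induction n with
  | zero => intro p hp; simp_all
  | succ n ih =>
    intro p hp
    have h1 : formDer b φ (p * X i) = φ (b i) • p + formDer b φ p * X i := by
      rw [Derivation.leibniz, formDer_X, MvPolynomial.smul_eq_C_mul]
      simp only [smul_eq_mul]; ring
    have hs : ∀ m : ℕ, ∀ q r : MvPolynomial ι k, ∀ c : k,
        (formDer b φ)^[m] (c • q + r) = c • (formDer b φ)^[m] q + (formDer b φ)^[m] r := by
      intro m
      induction m with
      | zero => simp
      | succ m im => intro q r c; simp [Function.iterate_succ_apply, im]
    rw [Function.iterate_succ_apply, h1, hs, hp, ih _ (by rwa [← Function.iterate_succ_apply])]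
    simp

lemma formDer_locally_nilpotent (b : Basis ι k L) (φ : Module.Dual k L) (p : MvPolynomial ι k) :
    ∃ n, (formDer b φ)^[n] p = 0 := by
  induction p using MvPolynomial.induction_on with
  | C a => exact ⟨1, by simp⟩
  | add p q hp hq =>
    obtain ⟨m, hm⟩ := hp
    obtain ⟨n, hn⟩ := hq
    refine ⟨m + n, ?_⟩
    rw [iterate_map_add]
    nth_rewrite 1 [add_comm m n]
    rw [Function.iterate_add_apply, Function.iterate_add_apply, hm, hn]
    simp
  | mul_X p i hp =>
    obtain ⟨n, hn⟩ := hp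
    exact ⟨n + 1, formDer_iterate_X_mul b φ i n p hn⟩

end FormDer

section Helpers

variable {ι V : Type} [Fintype ι]

lemma rep_eq_constr [AddCommGroup V] [Module k V] (bV : Basis ι k V) (w : V) :
    rep bV w = bV.constr k (X : ι → MvPolynomial ι k) w := by
  simp [rep, Basis.constr_apply_fintype, MvPolynomial.smul_eq_C_mul]

lemma rep_add [AddCommGroup V] [Module k V] (bV : Basis ι k V) (x y : V) :
    rep bV (x + y) = rep bV x + rep bV y := by
  simp only [rep_eq_constr, map_add]

lemma rep_neg [AddCommGroup V] [Module k V] (bV : Basis ι k V) (x : V) :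
    rep bV (-x) = -rep bV x := by
  simp only [rep_eq_constr, map_neg]

lemma rep_sub [AddCommGroup V] [Module k V] (bV : Basis ι k V) (x y : V) :
    rep bV (x - y) = rep bV x - rep bV y := by
  simp only [rep_eq_constr, map_sub]

lemma rep_smul [AddCommGroup V] [Module k V] (bV : Basis ι k V) (c : k) (x : V) :
    rep bV (c • x) = C c * rep bV x := by
  simp only [rep_eq_constr, map_smul, MvPolynomial.smul_eq_C_mul]

lemma rep_basis [AddCommGroup V] [Module k V] (bV : Basis ι k V) (i : ι) :
    rep bV (bV i) = X i := by
  rw [rep_eq_constr, Basis.constr_basis]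

/-- The composite of a `k`-linear map on `S(V)` with `rep` is determined by the images of the
variables. -/
lemma map_rep [AddCommGroup V] [Module k V] (bV : Basis ι k V)
    (D : MvPolynomial ι k →ₗ[k] MvPolynomial ι k) (F : V →ₗ[k] MvPolynomial ι k)
    (h : ∀ i, D (X i) = F (bV i)) (w : V) : D (rep bV w) = F w := by
  have : D ∘ₗ bV.constr k (X : ι → MvPolynomial ι k) = F := bV.ext fun i => by
    rw [LinearMap.comp_apply, Basis.constr_basis, h]
  rw [rep_eq_constr, ← this]; rfl

lemma actDer_X (b : Basis ι k L) (v : L) (i : ι) : actDer b v (X i) = rep b ⁅v, b i⁆ :=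
  mkDerivation_X _ _ _

lemma actDer_rep (b : Basis ι k L) (v w : L) : actDer b v (rep b w) = rep b ⁅v, w⁆ := by
  have := map_rep b (actDer b v).toLinearMap
    (b.constr k (X : ι → MvPolynomial ι k) ∘ₗ LieModule.toEnd k L L v)
    (fun i => by simp [actDer_X, rep_eq_constr]) w
  simpa [rep_eq_constr] using this

lemma actDer_add (b : Basis ι k L) (x y : L) : actDer b (x + y) = actDer b x + actDer b y :=
  derivation_ext fun i => by simp [actDer_X, add_lie, rep_add]

lemma actDer_smul (b : Basis ι k L) (c : k) (x : L) : actDer b (c • x) = c • actDer b x :=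
  derivation_ext fun i => by simp [actDer_X, rep_smul, MvPolynomial.smul_eq_C_mul]

lemma actDer_lie (b : Basis ι k L) (x y : L) :
    actDer b ⁅x, y⁆ = ⁅actDer b x, actDer b y⁆ :=
  derivation_ext fun i => by
    rw [Derivation.commutator_apply]
    simp only [actDer_X, actDer_rep, ← rep_sub]
    rw [lie_lie]

/-- The adjoint action of `𝔤` on `S𝔤` as a homomorphism of Lie algebras. -/
noncomputable def actHom (b : Basis ι k L) :
    L →ₗ⁅k⁆ Derivation k (MvPolynomial ι k) (MvPolynomial ι k) where
  toFun := actDer b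
  map_add' := actDer_add b
  map_smul' := actDer_smul b
  map_lie' {x y} := actDer_lie b x y

lemma formDer_rep (b : Basis ι k L) (φ : Module.Dual k L) (w : L) :
    formDer b φ (rep b w) = C (φ w) := by
  simpa using map_rep b (formDer b φ).toLinearMap
    (Algebra.linearMap k (MvPolynomial ι k) ∘ₗ φ)
    (fun i => by simp [formDer_X, MvPolynomial.algebraMap_eq]) w

/-- A linear form vanishing on brackets gives a derivation commuting with the adjoint action. -/
lemma formDer_actDer_comm (b : Basis ι k L) {φ : Module.Dual k L}
    (hφ : ∀ x y : L, φ ⁅x, y⁆ = 0) (x : L) (p : MvPolynomial ι k) :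
    formDer b φ (actDer b x p) = actDer b x (formDer b φ p) := by
  have : ⁅formDer b φ, actDer b x⁆ = 0 := derivation_ext fun i => by
    simp [Derivation.commutator_apply, actDer_X, formDer_X, formDer_rep, hφ]
  have h := Derivation.congr_fun this p
  rwa [Derivation.commutator_apply, Derivation.zero_apply, sub_eq_zero] at h

/-- Over a field of characteristic zero, the kernel of the derivation given by a linear form
`φ ≠ 0` is the symmetric algebra of the hyperplane `ker φ`. -/
lemma mem_adjoin_of_formDer_eq_zero [CharZero k] (b : Basis ι k L) (φ : Module.Dual k L)
    {v : L} (hv : φ v = 1) {p : MvPolynomial ι k} (hp : formDer b φ p = 0) :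
    p ∈ Algebra.adjoin k (rep b '' {x : L | φ x = 0}) := by
  set S := Algebra.adjoin k (rep b '' {x : L | φ x = 0})
  have hSδ : ∀ q ∈ S, formDer b φ q = 0 := by
    have := Derivation.eqOn_adjoin (D1 := formDer b φ) (D2 := 0)
      (s := rep b '' {x : L | φ x = 0}) (by
        rintro _ ⟨x, hx, rfl⟩
        have hx : φ x = 0 := hx
        simp [formDer_rep, hx])
    exact fun q hq => this hq
  have hdecomp : ∀ q : MvPolynomial ι k, ∃ a ∈ S, ∃ r, q = a + rep b v * r := by
    intro q
    induction q using MvPolynomial.induction_on with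
    | C a => exact ⟨C a, S.algebraMap_mem a, 0, by simp⟩
    | add p q hp hq =>
      obtain ⟨a, ha, r, rfl⟩ := hp
      obtain ⟨a', ha', r', rfl⟩ := hq
      exact ⟨a + a', S.add_mem ha ha', r + r', by ring⟩
    | mul_X p i hp =>
      obtain ⟨a, ha, r, rfl⟩ := hp
      have hX : X i = rep b (b i - φ (b i) • v) + C (φ (b i)) * rep b v := by
        rw [rep_sub, rep_smul, rep_basis]; ring
      refine ⟨a * rep b (b i - φ (b i) • v), S.mul_mem ha ?_,
        r * X i + a * C (φ (b i)), ?_⟩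
      · exact Algebra.subset_adjoin ⟨_, by simp [hv], rfl⟩
      · linear_combination a * hX
  obtain ⟨a, ha, r, rfl⟩ := hdecomp p
  have h0 : r + rep b v * formDer b φ r = 0 := by
    rw [map_add, hSδ a ha, Derivation.leibniz, formDer_rep, hv] at hp
    simp only [smul_eq_mul, map_one, mul_one] at hp
    linear_combination hp
  have hstep : ∀ m : ℕ, ((m : MvPolynomial ι k) + 1) * (formDer b φ)^[m] r +
      rep b v * (formDer b φ)^[m + 1] r = 0 := by
    intro m
    induction m with
    | zero => simpa using h0
    | succ m ih =>
      have h := congrArg (formDer b φ) ih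
      simp only [map_add, Derivation.leibniz, formDer_rep, hv, smul_eq_mul, map_one,
        Derivation.map_natCast, Derivation.map_one_eq_zero, map_zero,
        ← Function.iterate_succ_apply'] at h
      push_cast
      linear_combination h
  obtain ⟨n, hn⟩ := formDer_locally_nilpotent b φ r
  have hr : r = 0 := by
    induction n with
    | zero => simpa using hn
    | succ n ih =>
      apply ih
      have h := hstep n
      rw [hn, mul_zero, add_zero] at h
      exact (mul_eq_zero.1 h).resolve_left (by exact_mod_cast n.succ_ne_zero)
  simpa [hr] using ha

lemma mkDerivation_eq_sum (F : ι → MvPolynomial ι k) (g : MvPolynomial ι k) :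
    mkDerivation k F g = ∑ i, pderiv i g * F i := by
  classical
  have : mkDerivation k F = ∑ i, F i • pderiv i := derivation_ext fun j => by
    rw [mkDerivation_X, ← Derivation.coeFnAddMonoidHom_apply, map_sum, Finset.sum_apply]
    simp [Derivation.coeFnAddMonoidHom_apply, pderiv_X, Pi.single_apply]
  rw [this, ← Derivation.coeFnAddMonoidHom_apply, map_sum, Finset.sum_apply]
  simp [Derivation.coeFnAddMonoidHom_apply, mul_comm]

/-- The Poisson bracket of `S𝔤`. -/
noncomputable def poisson (b : Basis ι k L) (g f : MvPolynomial ι k) : MvPolynomial ι k :=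
  ∑ i, pderiv i g * actDer b (b i) f

lemma poisson_antisymm (b : Basis ι k L) (g f : MvPolynomial ι k) :
    poisson b g f = -poisson b f g := by
  simp only [poisson, actDer, mkDerivation_eq_sum, Finset.mul_sum, ← Finset.sum_neg_distrib]
  rw [Finset.sum_comm]
  refine Finset.sum_congr rfl fun i _ => Finset.sum_congr rfl fun j _ => ?_
  rw [← lie_skew, rep_neg]
  ring

lemma poisson_eq (b : Basis ι k L) (χ φ : Module.Dual k L) {f f' : MvPolynomial ι k}
    (h : ∀ x, actDer b x f = χ x • f + φ x • f') (g : MvPolynomial ι k) :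
    poisson b g f = formDer b χ g * f + formDer b φ g * f' := by
  simp only [poisson, formDer, mkDerivation_eq_sum, h, Finset.sum_mul,
    ← Finset.sum_add_distrib, MvPolynomial.smul_eq_C_mul]
  exact Finset.sum_congr rfl fun i _ => by ring

lemma poisson_semiInv (b : Basis ι k L) (l : Module.Dual k L) {f : MvPolynomial ι k}
    (h : ∀ x, actDer b x f = l x • f) (g : MvPolynomial ι k) :
    poisson b g f = formDer b l g * f := by
  simpa using poisson_eq b l 0 (f' := 0) (fun x => by simp [h]) g

/-- Given a semi-invariant `h` of degree one in the direction of `v`, the derivation `v`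
acts on the semi-invariants of a given weight as multiplication by a fixed fraction. -/
lemma sq_mul_actDer_eq (b : Basis ι k L) (χ φ l : Module.Dual k L) {v : L}
    {h : MvPolynomial ι k} (hh : ∀ x, actDer b x h = l x • h)
    (hA : ∀ x, actDer b x (formDer b φ h) = l x • formDer b φ h)
    (hδ : formDer b φ (formDer b φ h) = 0) {f : MvPolynomial ι k}
    (hf : ∀ x, actDer b x f = χ x • f + φ x • actDer b v f) :
    formDer b φ h ^ 2 * actDer b v f =
      (formDer b χ (formDer b φ h) * h - formDer b φ h * formDer b χ h) * f := by
  have e1 := poisson_eq b χ φ hf h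
  have e2 := poisson_eq b χ φ hf (formDer b φ h)
  rw [poisson_antisymm, poisson_semiInv b l hh] at e1
  rw [poisson_antisymm, poisson_semiInv b l hA, hδ] at e2
  linear_combination h * e2 - formDer b φ h * e1

/-- The adjoint action on `S𝔤` is locally finite. -/
lemma exists_finite_stable (b : Basis ι k L) (f : MvPolynomial ι k) :
    ∃ W : Submodule k (MvPolynomial ι k), W.FG ∧ f ∈ W ∧
      ∀ x : L, ∀ w ∈ W, actDer b x w ∈ W := by
  induction f using MvPolynomial.induction_on with
  | C a =>
    refine ⟨Submodule.span k {1}, Submodule.fg_span_singleton _, ?_, fun x w hw => ?_⟩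
    · exact Submodule.mem_span_singleton.2 ⟨a, by simp [MvPolynomial.smul_eq_C_mul]⟩
    · obtain ⟨c, rfl⟩ := Submodule.mem_span_singleton.1 hw
      simp
  | add p q hp hq =>
    obtain ⟨W, hW, hpW, hs⟩ := hp
    obtain ⟨W', hW', hqW, hs'⟩ := hq
    refine ⟨W ⊔ W', hW.sup hW', Submodule.add_mem_sup hpW hqW, fun x w hw => ?_⟩
    obtain ⟨y, hy, z, hz, rfl⟩ := Submodule.mem_sup.1 hw
    rw [map_add]
    exact Submodule.add_mem_sup (hs x y hy) (hs' x z hz)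
  | mul_X p i hp =>
    obtain ⟨W, hW, hpW, hs⟩ := hp
    have : Module.Finite k L := Module.Finite.of_basis b
    set R := LinearMap.range (b.constr k (X : ι → MvPolynomial ι k)) with hR
    have hmem : ∀ y, rep b y ∈ R := fun y => ⟨y, (rep_eq_constr b y).symm⟩
    refine ⟨W * R, hW.mul (hR ▸ Module.Finite.iff_fg.1 inferInstance), ?_, fun x w hw => ?_⟩
    · exact Submodule.mul_mem_mul hpW (rep_basis b i ▸ hmem (b i))
    · induction hw using Submodule.mul_induction_on' with
      | mem_mul_mem m hm n hn =>
        obtain ⟨y, rfl⟩ := hn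
        rw [← rep_eq_constr, Derivation.leibniz, actDer_rep, smul_eq_mul, smul_eq_mul,
          mul_comm (rep b y)]
        exact add_mem (Submodule.mul_mem_mul hm (hmem _))
          (Submodule.mul_mem_mul (hs x m hm) (hmem _))
      | add y _ z _ hy hz => rw [map_add]; exact add_mem hy hz

/-- In a finite-dimensional stable subspace, a nonzero weight space of an ideal
contains an eigenvector of any given element. -/
lemma exists_eigenvector_in_weightSpace [IsAlgClosed k] [CharZero k]
    [AddCommGroup V] [Module k V] [LieRingModule L V] [LieModule k L V]
    (W : LieSubmodule k L V) [Module.Finite k W] (I : LieIdeal k L) (χ : I → k)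
    {f : V} (hfW : f ∈ W) (hf0 : f ≠ 0) (hf : ∀ x : I, ⁅(x : L), f⁆ = χ x • f) (v : L) :
    ∃ g : V, g ≠ 0 ∧ (∀ x : I, ⁅(x : L), g⁆ = χ x • g) ∧ ∃ c : k, ⁅v, g⁆ = c • g := by
  let U : LieSubmodule k L W := LieModule.weightSpaceOfIsLieTower k W χ
  have hfU : (⟨f, hfW⟩ : W) ∈ LieModule.weightSpace W χ := by
    rw [LieModule.mem_weightSpace]
    exact fun x => Subtype.ext (hf x)
  have : Nontrivial U :=
    nontrivial_of_ne ⟨⟨f, hfW⟩, hfU⟩ 0 fun h => hf0 (congrArg (fun u : U => ((u : W) : V)) h)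
  obtain ⟨c, hc⟩ := Module.End.exists_eigenvalue (LieModule.toEnd k L U v)
  obtain ⟨⟨⟨g, hgW⟩, hgU⟩, hg⟩ := hc.exists_hasEigenvector
  have hgU' : (⟨g, hgW⟩ : W) ∈ LieModule.weightSpace W χ := hgU
  rw [LieModule.mem_weightSpace] at hgU'
  refine ⟨g, ?_, fun x => congrArg Subtype.val (hgU' x), c, ?_⟩
  · rintro rfl
    exact hg.2 rfl
  · exact congrArg (fun u : U => ((u : W) : V)) hg.apply_eq_smul

/-- Weights of an ideal in `S𝔤` contain eigenvectors of any given element. -/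
lemma exists_semiInv_eigenvector [IsAlgClosed k] [CharZero k] (b : Basis ι k L)
    (I : LieIdeal k L) (χ : I → k) {f : MvPolynomial ι k} (hf0 : f ≠ 0)
    (hf : ∀ x : I, actDer b (x : L) f = χ x • f) (v : L) :
    ∃ g : MvPolynomial ι k, g ≠ 0 ∧ (∀ x : I, actDer b (x : L) g = χ x • g) ∧
      ∃ c : k, actDer b v g = c • g := by
  let : LieRingModule L (MvPolynomial ι k) := LieRingModule.compLieHom _ (actHom b)
  have : LieModule k L (MvPolynomial ι k) := LieModule.compLieHom _ (actHom b)
  obtain ⟨W, hW, hfW, hs⟩ := exists_finite_stable b f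
  let W' : LieSubmodule k L (MvPolynomial ι k) := { W with lie_mem := fun {x m} hm => hs x m hm }
  have : Module.Finite k W' := Module.Finite.iff_fg.2 hW
  exact exists_eigenvector_in_weightSpace W' I χ hfW hf0 hf v

/-- A codimension-one ideal is the kernel of a linear form vanishing on brackets. -/
lemma exists_dual_of_codim_one (b : Basis ι k L) (H : LieSubalgebra k L)
    (hId : ∀ (y x : L), x ∈ H → ⁅y, x⁆ ∈ H) (hcodim : finrank k H + 1 = finrank k L) :
    ∃ (φ : Module.Dual k L) (v : L), φ v = 1 ∧ (∀ x, φ x = 0 ↔ x ∈ H) ∧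
      ∀ x y : L, φ ⁅x, y⁆ = 0 := by
  have : Module.Finite k L := Module.Finite.of_basis b
  have hq : finrank k (L ⧸ H.toSubmodule) = finrank k k := by
    have h1 := Submodule.finrank_quotient_add_finrank H.toSubmodule
    have h2 : finrank k H.toSubmodule = finrank k H := rfl
    rw [finrank_self]
    omega
  let e := LinearEquiv.ofFinrankEq _ _ hq
  obtain ⟨v, hv⟩ := H.toSubmodule.mkQ_surjective (e.symm 1)
  let φ : Module.Dual k L := e.toLinearMap ∘ₗ H.toSubmodule.mkQ
  have hφv : φ v = 1 := by
    change e (H.toSubmodule.mkQ v) = 1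
    rw [hv, LinearEquiv.apply_symm_apply]
  have hker : ∀ x, φ x = 0 ↔ x ∈ H := fun x => by
    change e (H.toSubmodule.mkQ x) = 0 ↔ _
    rw [LinearEquiv.map_eq_zero_iff]
    simp
  refine ⟨φ, v, hφv, hker, fun x y => ?_⟩
  have hmem : ∀ z, z - φ z • v ∈ H := fun z => (hker _).1 (by simp [hφv])
  rw [hker]
  have hxv : ⁅x, v⁆ ∈ H := by
    have h := H.neg_mem (hId v _ (hmem x))
    rwa [lie_skew, sub_lie, smul_lie, lie_self, smul_zero, sub_zero] at h
  have h := H.add_mem (hId x _ (hmem y)) (H.smul_mem (φ y) hxv)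
  rwa [← lie_smul, ← lie_add, sub_add_cancel] at h

/-- If some semi-invariant of `𝔤` is not killed by `formDer b φ`, there is one of degree one in
the direction transversal to `ker φ`. -/
lemma exists_semiInv_degree_one (b : Basis ι k L) {φ l : Module.Dual k L}
    (hφ : ∀ x y : L, φ ⁅x, y⁆ = 0) {f : MvPolynomial ι k}
    (hf : ∀ x, actDer b x f = l x • f) (hδ : formDer b φ f ≠ 0) :
    ∃ h : MvPolynomial ι k, (∀ x, actDer b x h = l x • h) ∧ formDer b φ h ≠ 0 ∧
      formDer b φ (formDer b φ h) = 0 := by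
  obtain ⟨n, hn⟩ := formDer_locally_nilpotent b φ f
  induction n generalizing f with
  | zero => exact absurd (by simp_all) hδ
  | succ n ih =>
    by_cases h2 : formDer b φ (formDer b φ f) = 0
    · exact ⟨f, hf, hδ, h2⟩
    · refine ih (f := formDer b φ f) (fun x => ?_) h2 hn
      rw [← formDer_actDer_comm b hφ, hf, Derivation.map_smul]

/-- If some semi-invariant of `𝔤` does not lie in the symmetric algebra of the codimension-one
ideal `I = ker φ`, every semi-invariant of `I` is a semi-invariant of `𝔤`. -/
lemma exists_weight_of_ideal_semiInv [IsAlgClosed k] [CharZero k] (b : Basis ι k L)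
    (I : LieIdeal k L) {φ l : Module.Dual k L} {v : L} (hv : φ v = 1)
    (hI : ∀ x, φ x = 0 ↔ x ∈ I) (hφ : ∀ x y : L, φ ⁅x, y⁆ = 0) {f₀ : MvPolynomial ι k}
    (hf₀ : ∀ x, actDer b x f₀ = l x • f₀) (hδ : formDer b φ f₀ ≠ 0)
    (χ : Module.Dual k I) {f : MvPolynomial ι k} (hf0 : f ≠ 0)
    (hf : ∀ x : I, actDer b (x : L) f = χ x • f) :
    ∃ χ' : Module.Dual k L, ∀ x, actDer b x f = χ' x • f := by
  obtain ⟨h, hh, hA, hδδ⟩ := exists_semiInv_degree_one b hφ hf₀ hδ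
  have hA' : ∀ x, actDer b x (formDer b φ h) = l x • formDer b φ h := fun x => by
    rw [← formDer_actDer_comm b hφ, hh, Derivation.map_smul]
  let π : L →ₗ[k] I := LinearMap.codRestrict I.toSubmodule
    (LinearMap.id - φ.smulRight v) (fun x => (hI _).1 (by simp [hv]))
  have hπ : ∀ x, x = (π x : L) + φ x • v := fun x =>
    (sub_add_cancel x (φ x • v)).symm
  have hsplit : ∀ g : MvPolynomial ι k, (∀ x : I, actDer b (x : L) g = χ x • g) →
      ∀ x, actDer b x g = (χ ∘ₗ π) x • g + φ x • actDer b v g := fun g hg x => by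
    conv_lhs => rw [hπ x]
    rw [actDer_add, actDer_smul, Derivation.add_apply, Derivation.smul_apply, hg]
    rfl
  obtain ⟨g, hg0, hg, c, hc⟩ := exists_semiInv_eigenvector b I χ hf0 hf v
  have eg := sq_mul_actDer_eq b _ φ l hh hA' hδδ (hsplit g hg)
  have ef := sq_mul_actDer_eq b _ φ l hh hA' hδδ (hsplit f hf)
  have hvf : actDer b v f = c • f := by
    rw [hc, MvPolynomial.smul_eq_C_mul, ← mul_assoc] at eg
    rw [← mul_right_cancel₀ hg0 eg, mul_assoc, ← MvPolynomial.smul_eq_C_mul] at ef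
    exact mul_left_cancel₀ (pow_ne_zero 2 hA) ef
  refine ⟨χ ∘ₗ π + c • φ, fun x => ?_⟩
  rw [hsplit f hf, hvf, LinearMap.add_apply, add_smul, LinearMap.smul_apply, smul_smul,
    smul_eq_mul, mul_comm c]

end Helpers

/-- If `𝔥` is a codimension-one ideal of `𝔤` then, viewing
`S𝔥 ⊆ S𝔤`, one of the inclusions `(S𝔥)^𝔤_si ⊆ (S𝔥)^𝔥_si`, `(S𝔥)^𝔤_si ⊆ (S𝔤)^𝔤_si`
is an equality. -/
theorem statement10 {k : Type} [Field k] [IsAlgClosed k] [CharZero k]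
    {L : Type} [LieRing L] [LieAlgebra k L]
    {ι : Type} [Fintype ι] [DecidableEq ι] (b : Basis ι k L)
    (H : LieSubalgebra k L)
    (hId : ∀ (y x : L), x ∈ H → ⁅y, x⁆ ∈ H)
    (hcodim : finrank k H + 1 = finrank k L)
    -- the image of `S𝔥` inside `S𝔤`
    (SH : Subalgebra k (MvPolynomial ι k))
    (hSH : SH = Algebra.adjoin k (Set.range fun x : H => rep b (x : L))) :
    Algebra.adjoin k {f | f ∈ SH ∧ f ∈ semiInvSet b (id : L → L)} =
        Algebra.adjoin k {f | f ∈ SH ∧ f ∈ semiInvSet b ((↑) : H → L)} ∨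
      Algebra.adjoin k {f | f ∈ SH ∧ f ∈ semiInvSet b (id : L → L)} =
        semiCenter b (id : L → L) := by
  obtain ⟨φ, v, hv, hker, hφ⟩ := exists_dual_of_codim_one b H hId hcodim
  by_cases hcase : ∀ f ∈ semiInvSet b (id : L → L), formDer b φ f = 0
  · right
    have hsub : ∀ f ∈ semiInvSet b (id : L → L), f ∈ SH := fun f hf => by
      have h := mem_adjoin_of_formDer_eq_zero b φ hv (hcase f hf)
      rw [hSH]
      refine Algebra.adjoin_mono ?_ h
      rintro _ ⟨x, hx, rfl⟩
      exact ⟨⟨x, (hker x).1 hx⟩, rfl⟩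
    refine congrArg (Algebra.adjoin k) (Set.ext fun f => ?_)
    exact ⟨fun hf => hf.2, fun hf => ⟨hsub f hf, hf⟩⟩
  · left
    push Not at hcase
    obtain ⟨f₀, ⟨-, l, hl⟩, hδ⟩ := hcase
    let I : LieIdeal k L := { H.toSubmodule with lie_mem := fun {x m} hm => hId x m hm }
    refine congrArg (Algebra.adjoin k) (Set.ext fun f => and_congr_right fun _ =>
      and_congr_right fun hf0 => ⟨?_, ?_⟩)
    · rintro ⟨χ, hχ⟩
      exact ⟨χ ∘ₗ H.toSubmodule.subtype, fun x => hχ x⟩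
    · rintro ⟨χ, hχ⟩
      exact exists_weight_of_ideal_semiInv b I hv hker hφ hl hδ χ hf0 hχ

end Paper
end
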